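/- arXiv:1408.1548 — 6 statements merged into one kernel-verified Lean document; each statement's English description precedes it below -/
import Mathlib

section
/- For every ω ∈ ℝ and every continuous 1-periodic function ψ : ℝ → ℝ, the denominator α(ω) β(ω,ψ) + β₊(ω,ψ) β₋(ω,ψ) is strictly positive (so A(ω,ψ) is well defined), and A(ω,ψ) has the same sign as ω: A(ω,ψ) > 0 for ω > 0, A(0,ψ) = 0, and A(ω,ψ) < 0 for ω < 0. -/
open MeasureTheory

/-- `α(ω) = e^ω − 1`. -/
noncomputable def ratchetAlpha (ω : ℝ) : ℝ := Real.exp ω - 1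

/-- `β₊(ω,ψ) = ∫₀¹ e^{ωx + ψ(x)} dx`. -/
noncomputable def ratchetBetaPlus (ω : ℝ) (ψ : ℝ → ℝ) : ℝ :=
  ∫ x in (0:ℝ)..1, Real.exp (ω * x + ψ x)

/-- `β₋(ω,ψ) = ∫₀¹ e^{−ωx − ψ(x)} dx`. -/
noncomputable def ratchetBetaMinus (ω : ℝ) (ψ : ℝ → ℝ) : ℝ :=
  ∫ x in (0:ℝ)..1, Real.exp (-(ω * x) - ψ x)

/-- `β(ω,ψ) = ∫₀¹ ∫₀^x e^{ωy + ψ(y) − ωx − ψ(x)} dy dx`. -/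
noncomputable def ratchetBeta (ω : ℝ) (ψ : ℝ → ℝ) : ℝ :=
  ∫ x in (0:ℝ)..1, ∫ y in (0:ℝ)..x, Real.exp (ω * y + ψ y - ω * x - ψ x)

/-- `A(ω,ψ) = α(ω) / (α(ω) β(ω,ψ) + β₊(ω,ψ) β₋(ω,ψ))`. -/
noncomputable def ratchetA (ω : ℝ) (ψ : ℝ → ℝ) : ℝ :=
  ratchetAlpha ω /
    (ratchetAlpha ω * ratchetBeta ω ψ + ratchetBetaPlus ω ψ * ratchetBetaMinus ω ψ)

/-- `B(ω,ψ) = β₊(ω,ψ) / (α(ω) β(ω,ψ) + β₊(ω,ψ) β₋(ω,ψ))`. -/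
noncomputable def ratchetB (ω : ℝ) (ψ : ℝ → ℝ) : ℝ :=
  ratchetBetaPlus ω ψ /
    (ratchetAlpha ω * ratchetBeta ω ψ + ratchetBetaPlus ω ψ * ratchetBetaMinus ω ψ)

theorem ratchetA_den_pos (ω : ℝ) (ψ : ℝ → ℝ) (hc : Continuous ψ) :
    0 < ratchetAlpha ω * ratchetBeta ω ψ + ratchetBetaPlus ω ψ * ratchetBetaMinus ω ψ := by
  have hf : Continuous fun y => Real.exp (ω * y + ψ y) := by fun_prop
  have hg : Continuous fun y => Real.exp (-(ω * y) - ψ y) := by fun_prop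
  have hi : ∀ a b, IntervalIntegrable (fun y => Real.exp (ω * y + ψ y)) volume a b :=
    fun a b => hf.intervalIntegrable a b
  have hF : Continuous fun x => ∫ y in (0:ℝ)..x, Real.exp (ω * y + ψ y) :=
    intervalIntegral.continuous_primitive hi 0
  have hB : ratchetBeta ω ψ = ∫ x in (0:ℝ)..1,
      Real.exp (-(ω * x) - ψ x) * ∫ y in (0:ℝ)..x, Real.exp (ω * y + ψ y) := by
    unfold ratchetBeta
    congr 1
    ext x
    rw [← intervalIntegral.integral_const_mul]
    congr 1
    ext y
    rw [← Real.exp_add]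
    congr 1
    ring
  have key : ratchetAlpha ω * ratchetBeta ω ψ + ratchetBetaPlus ω ψ * ratchetBetaMinus ω ψ
      = ∫ x in (0:ℝ)..1, (ratchetAlpha ω * (Real.exp (-(ω * x) - ψ x) *
          ∫ y in (0:ℝ)..x, Real.exp (ω * y + ψ y))
        + ratchetBetaPlus ω ψ * Real.exp (-(ω * x) - ψ x)) := by
    rw [intervalIntegral.integral_add, intervalIntegral.integral_const_mul,
      intervalIntegral.integral_const_mul, hB]
    · rfl
    · exact (continuous_const.mul (hg.mul hF)).intervalIntegrable _ _
    · exact (continuous_const.mul hg).intervalIntegrable _ _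
  rw [key]
  apply intervalIntegral.intervalIntegral_pos_of_pos_on
  · exact ((continuous_const.mul (hg.mul hF)).add (continuous_const.mul hg)).intervalIntegrable _ _
  · intro x hx
    have h1 : 0 < ∫ y in (0:ℝ)..x, Real.exp (ω * y + ψ y) :=
      intervalIntegral.intervalIntegral_pos_of_pos_on (hi _ _) (fun y _ => Real.exp_pos _) hx.1
    have h2 : 0 < ∫ y in x..1, Real.exp (ω * y + ψ y) :=
      intervalIntegral.intervalIntegral_pos_of_pos_on (hi _ _) (fun y _ => Real.exp_pos _) hx.2
    have h3 : ratchetBetaPlus ω ψ = (∫ y in (0:ℝ)..x, Real.exp (ω * y + ψ y))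
        + ∫ y in x..1, Real.exp (ω * y + ψ y) :=
      (intervalIntegral.integral_add_adjacent_intervals (hi _ _) (hi _ _)).symm
    rw [h3]
    unfold ratchetAlpha
    have h4 := Real.exp_pos (-(ω * x) - ψ x)
    have h5 := mul_pos h4 (add_pos (mul_pos (Real.exp_pos ω) h1) h2)
    refine h5.trans_eq ?_
    ring
  · norm_num

/-- The denominator of `A(ω,ψ)` is strictly positive, and `A(ω,ψ)` has the same sign
as `ω`. -/
theorem ratchetA_sign
    (ω : ℝ) (ψ : ℝ → ℝ) (hc : Continuous ψ) (hper : Function.Periodic ψ 1) :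
    0 < ratchetAlpha ω * ratchetBeta ω ψ + ratchetBetaPlus ω ψ * ratchetBetaMinus ω ψ ∧
    (0 < ω → 0 < ratchetA ω ψ) ∧
    ratchetA 0 ψ = 0 ∧
    (ω < 0 → ratchetA ω ψ < 0) := by
  have hp := ratchetA_den_pos ω ψ hc
  refine ⟨hp, fun h => ?_, ?_, fun h => ?_⟩
  · exact div_pos (sub_pos.2 (Real.one_lt_exp_iff.2 h)) hp
  · simp [ratchetA, ratchetAlpha]
  · exact div_neg_of_neg_of_pos (sub_neg.2 (Real.exp_lt_one_iff.2 h)) hp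
end

section
/- Let g₊ and g₋ be two continuous, strictly positive 1-periodic probability densities on the circle, and set M₊ = √2 · max_x |ln(g₋(x)/g₊(x))|. Then for every probability density g on the circle with ∫₀¹ g ln g dx < ∞ one has |E[g | g₊] − E[g₋ | g₊]| ≤ E[g | g₋] + M₊ √(E[g | g₋]). Symmetrically, with M₋ = √2 · max_x |ln(g₊(x)/g₋(x))|, one has |E[g | g₋] − E[g₊ | g₋]| ≤ E[g | g₊] + M₋ √(E[g | g₊]). -/
open MeasureTheory

/-- Relative entropy `E[g | h] = ∫₀¹ g ln (g/h)` of two probability densities on the circle. -/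
noncomputable def relEnt (g h : ℝ → ℝ) : ℝ :=
  ∫ x in (0:ℝ)..1, g x * Real.log (g x / h x)


lemma log_lower (u : ℝ) (hu : 0 < u) :
    (u - 1) * (5 * u + 1) / (2 * u * (u + 2)) ≤ Real.log u := by
  let G : ℝ → ℝ := fun u => Real.log u - (u - 1) * (5 * u + 1) / (2 * u * (u + 2))
  have hd : ∀ v : ℝ, 0 < v → HasDerivAt G ((v - 1) ^ 3 / (v ^ 2 * (v + 2) ^ 2)) v := by
    intro v hv
    have h1 := Real.hasDerivAt_log hv.ne'
    have hN : HasDerivAt (fun u : ℝ => (u - 1) * (5 * u + 1))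
        (1 * (5 * v + 1) + (v - 1) * (5 * 1)) v :=
      ((hasDerivAt_id' v).sub_const 1).mul (((hasDerivAt_id' v).const_mul 5).add_const 1)
    have hD : HasDerivAt (fun u : ℝ => (2 * u) * (u + 2))
        ((2 * 1) * (v + 2) + (2 * v) * 1) v :=
      ((hasDerivAt_id' v).const_mul 2).mul ((hasDerivAt_id' v).add_const 2)
    have h2 := h1.sub (hN.div hD (by positivity))
    refine h2.congr_deriv ?_
    field_simp
    ring
  have hG1 : G 1 = 0 := by simp [G]
  have key : 0 ≤ G u := by
    rcases le_total u 1 with h | h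
    · have hanti : AntitoneOn G (Set.Icc u 1) := by
        apply antitoneOn_of_deriv_nonpos (convex_Icc u 1)
        · intro v hv
          exact (hd v (by linarith [hv.1])).continuousAt.continuousWithinAt
        · intro v hv
          rw [interior_Icc] at hv
          exact (hd v (by linarith [hv.1])).differentiableAt.differentiableWithinAt
        · intro v hv
          rw [interior_Icc] at hv
          have hv0 : 0 < v := by linarith [hv.1]
          rw [(hd v hv0).deriv]
          apply div_nonpos_of_nonpos_of_nonneg _ (by positivity)
          have : v - 1 ≤ 0 := by linarith [hv.2]
          exact Odd.pow_nonpos (by decide) this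
      have := hanti (Set.left_mem_Icc.2 h) (Set.right_mem_Icc.2 h) h
      linarith
    · have hmono : MonotoneOn G (Set.Icc 1 u) := by
        apply monotoneOn_of_deriv_nonneg (convex_Icc 1 u)
        · intro v hv
          exact (hd v (by linarith [hv.1])).continuousAt.continuousWithinAt
        · intro v hv
          rw [interior_Icc] at hv
          exact (hd v (by linarith [hv.1])).differentiableAt.differentiableWithinAt
        · intro v hv
          rw [interior_Icc] at hv
          have hv0 : 0 < v := by linarith [hv.1]
          rw [(hd v hv0).deriv]
          have : 0 ≤ v - 1 := by linarith [hv.1]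
          positivity
      have := hmono (Set.left_mem_Icc.2 h) (Set.right_mem_Icc.2 h) h
      linarith
  simp only [G] at key
  linarith

lemma pointwise_sq (a h : ℝ) (ha : 0 ≤ a) (hh : 0 < h) :
    3 * (a - h) ^ 2 ≤ (2 * a + 4 * h) * (a * Real.log (a / h) - a + h) := by
  rcases ha.eq_or_lt with rfl | ha
  · simp
    nlinarith
  · have h1 := log_lower (a / h) (by positivity)
    have e : (a / h - 1) * (5 * (a / h) + 1) / (2 * (a / h) * (a / h + 2))
        = (a - h) * (5 * a + h) / (a * (2 * a + 4 * h)) := by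
      field_simp
      ring
    rw [e, div_le_iff₀ (by positivity)] at h1
    nlinarith

lemma pointwise_abs (a h t : ℝ) (ha : 0 ≤ a) (hh : 0 < h) (ht : 0 < t) :
    |a - h| ≤ t / 3 * (a + 2 * h) + (1 / (2 * t)) * (a * Real.log (a / h) - a + h) := by
  have h1 := pointwise_sq a h ha hh
  set p := a * Real.log (a / h) - a + h
  have hp : 0 ≤ p := by
    by_contra hneg
    have : (2 * a + 4 * h) * p < 0 := mul_neg_of_pos_of_neg (by positivity) (by linarith)
    nlinarith [sq_nonneg (a - h)]
  apply abs_le_of_sq_le_sq _ (by positivity)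
  have e : 4 * (t / 3 * (a + 2 * h)) * (1 / (2 * t) * p) = (2 * a + 4 * h) * p / 3 := by
    field_simp
    ring
  nlinarith [sq_nonneg (t / 3 * (a + 2 * h) - 1 / (2 * t) * p)]

lemma mul_log_div (a h : ℝ) (hh : 0 < h) :
    a * Real.log (a / h) = a * Real.log a - a * Real.log h := by
  by_cases ha : a = 0
  · simp [ha]
  · rw [Real.log_div ha hh.ne']
    ring

lemma integrable_ent (g h : ℝ → ℝ) (hc : Continuous h) (hpos : ∀ x, 0 < h x)
    (hgint : IntervalIntegrable g volume 0 1)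
    (hglog : IntervalIntegrable (fun x => g x * Real.log (g x)) volume 0 1) :
    IntervalIntegrable (fun x => g x * Real.log (g x / h x)) volume 0 1 := by
  have hl : Continuous (fun x => Real.log (h x)) := hc.log (fun x => (hpos x).ne')
  have h1 := hglog.sub (hgint.mul_continuousOn hl.continuousOn)
  refine h1.congr ?_
  intro x _
  exact (mul_log_div (g x) (h x) (hpos x)).symm

/-- Csiszár–Kullback inequality (and nonnegativity of the entropy). -/
lemma csiszar_kullback (g h : ℝ → ℝ) (hc : Continuous h) (hpos : ∀ x, 0 < h x)
    (hn : (∫ x in (0:ℝ)..1, h x) = 1) (hgnn : ∀ x, 0 ≤ g x)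
    (hgint : IntervalIntegrable g volume 0 1)
    (hgn : (∫ x in (0:ℝ)..1, g x) = 1)
    (hglog : IntervalIntegrable (fun x => g x * Real.log (g x)) volume 0 1) :
    (∫ x in (0:ℝ)..1, |g x - h x|) ≤ Real.sqrt 2 * Real.sqrt (relEnt g h) := by
  have hI := integrable_ent g h hc hpos hgint hglog
  have hhI : IntervalIntegrable h volume 0 1 := hc.intervalIntegrable 0 1
  have hE : (∫ x in (0:ℝ)..1, (g x * Real.log (g x / h x) - g x + h x)) = relEnt g h := by
    rw [intervalIntegral.integral_add (hI.sub hgint) hhI,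
      intervalIntegral.integral_sub hI hgint, hn, hgn, relEnt]
    ring
  have hEt : ∀ t : ℝ, 0 < t →
      (∫ x in (0:ℝ)..1, |g x - h x|) ≤ t + 1 / (2 * t) * relEnt g h := by
    intro t ht
    have i1 : IntervalIntegrable (fun x => t / 3 * (g x + 2 * h x)) volume 0 1 :=
      (hgint.add (hhI.const_mul 2)).const_mul _
    have i2 : IntervalIntegrable
        (fun x => 1 / (2 * t) * (g x * Real.log (g x / h x) - g x + h x)) volume 0 1 :=
      ((hI.sub hgint).add hhI).const_mul _
    have := intervalIntegral.integral_mono_on zero_le_one (hgint.sub hhI).abs (i1.add i2)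
      (fun x _ => pointwise_abs (g x) (h x) t (hgnn x) (hpos x) ht)
    rw [intervalIntegral.integral_add i1 i2, intervalIntegral.integral_const_mul,
      intervalIntegral.integral_const_mul, hE,
      intervalIntegral.integral_add hgint (hhI.const_mul 2),
      intervalIntegral.integral_const_mul, hgn, hn] at this
    refine this.trans (le_of_eq ?_)
    ring
  have hA : 0 ≤ ∫ x in (0:ℝ)..1, |g x - h x| :=
    intervalIntegral.integral_nonneg zero_le_one (fun x _ => abs_nonneg _)
  rcases le_or_gt (relEnt g h) 0 with h0 | h0
  · have : (∫ x in (0:ℝ)..1, |g x - h x|) ≤ 0 := by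
      apply le_of_forall_pos_le_add
      intro t ht
      have h1 := hEt t ht
      have h2 : 1 / (2 * t) * relEnt g h ≤ 0 :=
        mul_nonpos_of_nonneg_of_nonpos (by positivity) h0
      linarith
    exact this.trans (by positivity)
  · set E := relEnt g h
    have hs : 0 < Real.sqrt E := Real.sqrt_pos.2 h0
    have hs2 : 0 < Real.sqrt 2 := by positivity
    have h1 := hEt (Real.sqrt E / Real.sqrt 2) (by positivity)
    refine h1.trans (le_of_eq ?_)
    have e1 : Real.sqrt E ^ 2 = E := Real.sq_sqrt h0.le
    have e2 : Real.sqrt 2 ^ 2 = 2 := Real.sq_sqrt (by norm_num)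
    generalize Real.sqrt E = s at *
    generalize Real.sqrt 2 = r at *
    rw [← e1]
    field_simp
    linear_combination (-1) * e2

lemma one_side (gp gm g : ℝ → ℝ)
    (hgpc : Continuous gp) (hgmc : Continuous gm)
    (hgppos : ∀ x, 0 < gp x) (hgmpos : ∀ x, 0 < gm x)
    (hgmn : (∫ x in (0:ℝ)..1, gm x) = 1)
    (hgnn : ∀ x, 0 ≤ g x)
    (hgint : IntervalIntegrable g volume 0 1)
    (hgn : (∫ x in (0:ℝ)..1, g x) = 1)
    (hglog : IntervalIntegrable (fun x => g x * Real.log (g x)) volume 0 1) :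
    |relEnt g gp - relEnt gm gp| ≤
      relEnt g gm +
        (Real.sqrt 2 * sSup ((fun x => |Real.log (gm x / gp x)|) '' Set.Icc 0 1)) *
          Real.sqrt (relEnt g gm) := by
  have hLc : Continuous (fun x => Real.log (gm x / gp x)) :=
    (hgmc.div hgpc (fun x => (hgppos x).ne')).log
      (fun x => (div_pos (hgmpos x) (hgppos x)).ne')
  set M := sSup ((fun x => |Real.log (gm x / gp x)|) '' Set.Icc 0 1) with hM
  have hbdd : BddAbove ((fun x => |Real.log (gm x / gp x)|) '' Set.Icc (0:ℝ) 1) :=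
    (isCompact_Icc.image hLc.abs).bddAbove
  have hMle : ∀ x ∈ Set.Icc (0:ℝ) 1, |Real.log (gm x / gp x)| ≤ M :=
    fun x hx => le_csSup hbdd ⟨x, hx, rfl⟩
  have hM0 : 0 ≤ M := (abs_nonneg _).trans (hMle 0 (by simp))
  have hmI : IntervalIntegrable gm volume 0 1 := hgmc.intervalIntegrable 0 1
  have hdI := hgint.sub hmI
  have iD := integrable_ent g gm hgmc hgmpos hgint hglog
  have iX : IntervalIntegrable (fun x => (g x - gm x) * Real.log (gm x / gp x)) volume 0 1 :=
    hdI.mul_continuousOn hLc.continuousOn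
  have iP := integrable_ent g gp hgpc hgppos hgint hglog
  have iM : IntervalIntegrable (fun x => gm x * Real.log (gm x / gp x)) volume 0 1 :=
    (hgmc.mul hLc).intervalIntegrable 0 1
  have hsplit : relEnt g gp - relEnt gm gp =
      relEnt g gm + ∫ x in (0:ℝ)..1, (g x - gm x) * Real.log (gm x / gp x) := by
    unfold relEnt
    rw [← intervalIntegral.integral_sub iP iM, ← intervalIntegral.integral_add iD iX]
    congr 1
    funext x
    rw [mul_log_div _ _ (hgppos x), mul_log_div (g x) _ (hgmpos x),
      Real.log_div (hgmpos x).ne' (hgppos x).ne']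
    ring
  have hE0 : 0 ≤ relEnt g gm := by
    have h1 := intervalIntegral.integral_mono_on zero_le_one hdI iD (fun x _ => by
      have h1 := pointwise_sq (g x) (gm x) (hgnn x) (hgmpos x)
      have h2 := hgnn x
      have h3 := hgmpos x
      by_contra hneg
      have : (2 * g x + 4 * gm x) * (g x * Real.log (g x / gm x) - g x + gm x) < 0 :=
        mul_neg_of_pos_of_neg (by positivity) (by linarith)
      nlinarith [sq_nonneg (g x - gm x)])
    rw [intervalIntegral.integral_sub hgint hmI, hgn, hgmn] at h1
    simpa [relEnt] using h1
  have hX : |∫ x in (0:ℝ)..1, (g x - gm x) * Real.log (gm x / gp x)| ≤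
      M * ∫ x in (0:ℝ)..1, |g x - gm x| := by
    refine (intervalIntegral.abs_integral_le_integral_abs zero_le_one).trans ?_
    rw [← intervalIntegral.integral_const_mul]
    refine intervalIntegral.integral_mono_on zero_le_one iX.abs (hdI.abs.const_mul M) ?_
    intro x hx
    rw [abs_mul, mul_comm]
    exact mul_le_mul_of_nonneg_right (hMle x hx) (abs_nonneg _)
  have hck := csiszar_kullback g gm hgmc hgmpos hgmn hgnn hgint hgn hglog
  have h3 := mul_le_mul_of_nonneg_left hck hM0
  rw [hsplit]
  refine (abs_add_le _ _).trans ?_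
  rw [abs_of_nonneg hE0]
  nlinarith

/-- Comparison of relative entropies with respect to two positive reference densities:
`|E[g | g₊] − E[g₋ | g₊]| ≤ E[g | g₋] + M₊ √(E[g | g₋])` with
`M₊ = √2 max |ln(g₋/g₊)|`, and symmetrically. -/
theorem relEnt_comparison
    (gp gm g : ℝ → ℝ)
    (hgpc : Continuous gp) (hgmc : Continuous gm)
    (hgppos : ∀ x, 0 < gp x) (hgmpos : ∀ x, 0 < gm x)
    (hgpper : Function.Periodic gp 1) (hgmper : Function.Periodic gm 1)
    (hgpn : (∫ x in (0:ℝ)..1, gp x) = 1) (hgmn : (∫ x in (0:ℝ)..1, gm x) = 1)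
    (hgnn : ∀ x, 0 ≤ g x) (hgper : Function.Periodic g 1)
    (hgint : IntervalIntegrable g MeasureTheory.volume 0 1)
    (hgn : (∫ x in (0:ℝ)..1, g x) = 1)
    (hglog : IntervalIntegrable (fun x => g x * Real.log (g x)) MeasureTheory.volume 0 1) :
    |relEnt g gp - relEnt gm gp| ≤
      relEnt g gm +
        (Real.sqrt 2 * sSup ((fun x => |Real.log (gm x / gp x)|) '' Set.Icc 0 1)) *
          Real.sqrt (relEnt g gm) ∧
    |relEnt g gm - relEnt gp gm| ≤
      relEnt g gp +
        (Real.sqrt 2 * sSup ((fun x => |Real.log (gp x / gm x)|) '' Set.Icc 0 1)) *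
          Real.sqrt (relEnt g gp) := by
  exact ⟨one_side gp gm g hgpc hgmc hgppos hgmpos hgmn hgnn hgint hgn hglog,
    one_side gm gp g hgmc hgpc hgmpos hgppos hgpn hgnn hgint hgn hglog⟩
end

section
/- Let ψ : ℝ → ℝ be continuous and 1-periodic and let ω ≠ 0. Then 1/A(ω,ψ) + 1/A(−ω,ψ) = J(ψ,ω), where J(ψ,ω) = (2 / sinh(ω/2)) ∫₀¹ ∫₀^x sinh(ψ(x) − ψ(y)) · sinh(ω(x − y − 1/2)) dy dx. Consequently, the sign of v_{∞∞} = −(A(ω,ψ) + A(−ω,ψ))/2 coincides with the sign of J(ψ,ω): v_{∞∞} > 0 if J > 0, v_{∞∞} < 0 if J < 0, and v_{∞∞} = 0 if J = 0. -/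
open MeasureTheory

/-- `J(ψ,ω) = (2/sinh(ω/2)) ∫₀¹ ∫₀^x sinh(ψ(x) − ψ(y)) sinh(ω(x − y − 1/2)) dy dx`. -/
noncomputable def ratchetJ (ψ : ℝ → ℝ) (ω : ℝ) : ℝ :=
  (2 / Real.sinh (ω / 2)) *
    ∫ x in (0:ℝ)..1, ∫ y in (0:ℝ)..x,
      Real.sinh (ψ x - ψ y) * Real.sinh (ω * (x - y - 1 / 2))

/-- `K(ω) = ∫₀¹ ∫₀^x cosh(ψ(x) − ψ(y) + ω(x − y − 1/2)) dy dx`. -/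
noncomputable def ratchetK (ω : ℝ) (ψ : ℝ → ℝ) : ℝ :=
  ∫ x in (0:ℝ)..1, ∫ y in (0:ℝ)..x, Real.cosh (ψ x - ψ y + ω * (x - y - 1 / 2))

lemma ratchet_inner_cont (ψ : ℝ → ℝ) (hc : Continuous ψ) (ω : ℝ) :
    Continuous fun x : ℝ => ∫ y in (0:ℝ)..x, Real.cosh (ψ x - ψ y + ω * (x - y - 1 / 2)) := by
  apply intervalIntegral.continuous_parametric_intervalIntegral_of_continuous
  · have := Real.continuous_cosh
    simp only [Function.uncurry_def]
    fun_prop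
  · fun_prop

lemma ratchetK_pos (ψ : ℝ → ℝ) (hc : Continuous ψ) (ω : ℝ) : 0 < ratchetK ω ψ := by
  unfold ratchetK
  apply intervalIntegral.intervalIntegral_pos_of_pos_on
  · exact (ratchet_inner_cont ψ hc ω).intervalIntegrable _ _
  · intro x hx
    apply intervalIntegral.intervalIntegral_pos_of_pos_on
    · apply Continuous.intervalIntegrable
      have := Real.continuous_cosh
      fun_prop
    · intro y _
      exact Real.cosh_pos _
    · exact hx.1
  · norm_num

lemma ratchet_denom (ψ : ℝ → ℝ) (hc : Continuous ψ) (ω : ℝ) :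
    ratchetAlpha ω * ratchetBeta ω ψ + ratchetBetaPlus ω ψ * ratchetBetaMinus ω ψ
      = 2 * Real.exp (ω / 2) * ratchetK ω ψ := by
  set p : ℝ → ℝ := fun x => Real.exp (ω * x + ψ x) with hp
  set m : ℝ → ℝ := fun x => Real.exp (-(ω * x) - ψ x) with hm
  have cp : Continuous p := by fun_prop
  have cm : Continuous m := by fun_prop
  set P : ℝ → ℝ := fun x => ∫ y in (0:ℝ)..x, p y with hP
  set M : ℝ → ℝ := fun x => ∫ y in (0:ℝ)..x, m y with hM
  have dP : ∀ x, HasDerivAt P (p x) x := fun x => cp.integral_hasStrictDerivAt 0 x |>.hasDerivAt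
  have dM : ∀ x, HasDerivAt M (m x) x := fun x => cm.integral_hasStrictDerivAt 0 x |>.hasDerivAt
  have cP : Continuous P := continuous_iff_continuousAt.2 fun x => (dP x).continuousAt
  have cM : Continuous M := continuous_iff_continuousAt.2 fun x => (dM x).continuousAt
  have parts := intervalIntegral.integral_deriv_mul_eq_sub (a := 0) (b := 1)
    (fun x _ => dP x) (fun x _ => dM x) (cp.intervalIntegrable _ _) (cm.intervalIntegrable _ _)
  have hP0 : P 0 = 0 := by simp [hP]
  have hbeta : ratchetBeta ω ψ = ∫ x in (0:ℝ)..1, P x * m x := by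
    unfold ratchetBeta
    congr 1
    ext x
    rw [hP, ← intervalIntegral.integral_mul_const]
    congr 1
    ext y
    simp only [hp, hm, ← Real.exp_add]
    congr 1
    ring
  have i1 : IntervalIntegrable (fun x => p x * M x) volume 0 1 :=
    (cp.mul cM).intervalIntegrable _ _
  have i2 : IntervalIntegrable (fun x => P x * m x) volume 0 1 :=
    (cP.mul cm).intervalIntegrable _ _
  have hK : 2 * Real.exp (ω / 2) * ratchetK ω ψ
      = ∫ x in (0:ℝ)..1, (p x * M x + Real.exp ω * (P x * m x)) := by
    unfold ratchetK
    rw [← intervalIntegral.integral_const_mul]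
    congr 1
    ext x
    have e1 : p x * M x + Real.exp ω * (P x * m x)
        = ∫ y in (0:ℝ)..x, (p x * m y + (Real.exp ω * m x) * p y) := by
      rw [intervalIntegral.integral_add ((cm.const_mul _).intervalIntegrable _ _)
        ((cp.const_mul _).intervalIntegrable _ _), intervalIntegral.integral_const_mul,
        intervalIntegral.integral_const_mul]
      simp only [hP, hM]
      ring
    rw [e1, ← intervalIntegral.integral_const_mul]
    congr 1
    ext y
    simp only [hp, hm, Real.cosh_eq, ← Real.exp_add]
    have : ∀ a b c : ℝ, 2 * a * ((b + c) / 2) = a * b + a * c := by intros; ring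
    rw [this, ← Real.exp_add, ← Real.exp_add]
    congr 2 <;> ring
  rw [intervalIntegral.integral_add i1 i2, hP0] at parts
  rw [hK, intervalIntegral.integral_add i1 (i2.const_mul _), intervalIntegral.integral_const_mul,
    hbeta]
  have hpm : ratchetBetaPlus ω ψ * ratchetBetaMinus ω ψ = P 1 * M 1 := rfl
  rw [hpm]
  unfold ratchetAlpha
  linear_combination -parts

lemma ratchetA_eq (ψ : ℝ → ℝ) (hc : Continuous ψ) (ω : ℝ) :
    ratchetA ω ψ = Real.sinh (ω / 2) / ratchetK ω ψ := by
  have hk := ratchetK_pos ψ hc ω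
  have he := Real.exp_pos (ω / 2)
  have ha : ratchetAlpha ω = 2 * Real.exp (ω / 2) * Real.sinh (ω / 2) := by
    unfold ratchetAlpha
    rw [Real.sinh_eq, Real.exp_neg]
    have : Real.exp ω = Real.exp (ω / 2) * Real.exp (ω / 2) := by
      rw [← Real.exp_add]; congr 1; ring
    rw [this]
    field_simp
  unfold ratchetA
  rw [ratchet_denom ψ hc ω, ha]
  field_simp

lemma ratchetJ_eq (ψ : ℝ → ℝ) (hc : Continuous ψ) (ω : ℝ) :
    ratchetJ ψ ω = (ratchetK ω ψ - ratchetK (-ω) ψ) / Real.sinh (ω / 2) := by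
  have key : ratchetK ω ψ - ratchetK (-ω) ψ = 2 * ∫ x in (0:ℝ)..1, ∫ y in (0:ℝ)..x,
      Real.sinh (ψ x - ψ y) * Real.sinh (ω * (x - y - 1 / 2)) := by
    unfold ratchetK
    rw [← intervalIntegral.integral_sub
      ((ratchet_inner_cont ψ hc ω).intervalIntegrable _ _)
      ((ratchet_inner_cont ψ hc (-ω)).intervalIntegrable _ _),
      ← intervalIntegral.integral_const_mul]
    congr 1
    ext x
    have := Real.continuous_cosh
    rw [← intervalIntegral.integral_sub
      (Continuous.intervalIntegrable (by fun_prop) _ _)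
      (Continuous.intervalIntegrable (by fun_prop) _ _),
      ← intervalIntegral.integral_const_mul]
    congr 1
    ext y
    rw [neg_mul, ← sub_eq_add_neg, Real.cosh_add (ψ x - ψ y), Real.cosh_sub (ψ x - ψ y)]
    ring
  rw [key]
  unfold ratchetJ
  ring

/-- `1/A(ω,ψ) + 1/A(−ω,ψ) = J(ψ,ω)`, and the sign of the adiabatic drift velocity
`v_{∞∞} = −(A(ω,ψ) + A(−ω,ψ))/2` coincides with the sign of `J(ψ,ω)`. -/
theorem transport_direction
    (ψ : ℝ → ℝ) (hc : Continuous ψ) (hper : Function.Periodic ψ 1)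
    (ω : ℝ) (hω : ω ≠ 0) :
    1 / ratchetA ω ψ + 1 / ratchetA (-ω) ψ = ratchetJ ψ ω ∧
    (0 < ratchetJ ψ ω → 0 < -(ratchetA ω ψ + ratchetA (-ω) ψ) / 2) ∧
    (ratchetJ ψ ω < 0 → -(ratchetA ω ψ + ratchetA (-ω) ψ) / 2 < 0) ∧
    (ratchetJ ψ ω = 0 → -(ratchetA ω ψ + ratchetA (-ω) ψ) / 2 = 0) := by
  have hk := ratchetK_pos ψ hc ω
  have hk' := ratchetK_pos ψ hc (-ω)
  have hs : Real.sinh (ω / 2) ≠ 0 := by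
    rw [Ne, Real.sinh_eq_zero]
    simpa using hω
  have hs2 : 0 < Real.sinh (ω / 2) ^ 2 := by positivity
  have hv : -(ratchetA ω ψ + ratchetA (-ω) ψ) / 2
      = ratchetJ ψ ω * (Real.sinh (ω / 2) ^ 2 / (2 * ratchetK ω ψ * ratchetK (-ω) ψ)) := by
    rw [ratchetA_eq ψ hc, ratchetA_eq ψ hc, ratchetJ_eq ψ hc, neg_div 2 ω, Real.sinh_neg]
    field_simp
    ring
  have hpos : 0 < Real.sinh (ω / 2) ^ 2 / (2 * ratchetK ω ψ * ratchetK (-ω) ψ) := by positivity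
  refine ⟨?_, ?_, ?_, ?_⟩
  · rw [ratchetA_eq ψ hc, ratchetA_eq ψ hc, ratchetJ_eq ψ hc, neg_div 2 ω, Real.sinh_neg]
    field_simp
    ring
  · intro h
    rw [hv]
    exact mul_pos h hpos
  · intro h
    rw [hv]
    exact mul_neg_of_neg_of_pos h hpos
  · intro h
    rw [hv, h, zero_mul]
end

section
/- Let ψ : ℝ → ℝ be continuous and 1-periodic with ψ(x) = ψ(1 − x) for all x (a symmetric potential), and let ω ≠ 0. Then J(ψ,ω) = 0, and consequently A(ω,ψ) + A(−ω,ψ) = 0, i.e. the adiabatic drift velocity v_{∞∞} vanishes. -/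
open MeasureTheory

open intervalIntegral in
/-- Reflection `(x, y) ↦ (1 - y, 1 - x)` on the triangle `0 ≤ y ≤ x ≤ 1`. -/
lemma ratchet_triangle (F : ℝ → ℝ → ℝ) (hF : Continuous (Function.uncurry F)) :
    ∫ x in (0:ℝ)..1, ∫ y in (0:ℝ)..x, F x y
      = ∫ x in (0:ℝ)..1, ∫ y in (0:ℝ)..x, F (1 - y) (1 - x) := by
  have h1 : ∫ x in (0:ℝ)..1, ∫ y in (0:ℝ)..x, F x y
      = ∫ x in (0:ℝ)..1, ∫ y in (0:ℝ)..1, Set.indicator {y | y ≤ x} (F x) y := by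
    apply integral_congr
    intro x hx
    rw [Set.uIcc_of_le zero_le_one] at hx
    exact (integral_indicator hx).symm
  rw [h1, intervalIntegral_intervalIntegral_swap]
  · have h4 := integral_comp_sub_left (a := 0) (b := 1)
      (fun y => ∫ x in (0:ℝ)..1, Set.indicator {y | y ≤ x} (F x) y) 1
    simp only [sub_self, sub_zero] at h4
    rw [← h4]
    apply integral_congr
    intro x hx
    rw [Set.uIcc_of_le zero_le_one] at hx
    have h2 := integral_comp_sub_left (a := 0) (b := 1)
      (fun z => Set.indicator {y | y ≤ z} (F z) (1 - x)) 1
    simp only [sub_self, sub_zero] at h2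
    have h3 := integral_indicator (μ := volume) (f := fun y => F (1 - y) (1 - x)) hx
    simp only
    rw [← h2, ← h3]
    congr 1
    ext y
    have h5 : (1 - x ≤ 1 - y) = (y ≤ x) := propext (sub_le_sub_iff_left 1)
    simp only [Set.indicator, Set.mem_setOf_eq, h5]
  · rw [Set.uIoc_of_le zero_le_one]
    have hi : IntegrableOn (Function.uncurry F) (Set.Ioc (0:ℝ) 1 ×ˢ Set.Ioc (0:ℝ) 1) :=
      (hF.continuousOn.integrableOn_compact (isCompact_Icc.prod isCompact_Icc)).mono_set
        (Set.prod_mono Set.Ioc_subset_Icc_self Set.Ioc_subset_Icc_self)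
    have hm : MeasurableSet {p : ℝ × ℝ | p.2 ≤ p.1} :=
      measurableSet_le measurable_snd measurable_fst
    have := Integrable.indicator hi hm
    exact this.congr (Filter.Eventually.of_forall fun p => by simp [Set.indicator, Function.uncurry])

lemma ratchetBetaPlus_neg (ψ : ℝ → ℝ) (hsym : ∀ x : ℝ, ψ x = ψ (1 - x)) (ω : ℝ) :
    ratchetBetaPlus (-ω) ψ = Real.exp (-ω) * ratchetBetaPlus ω ψ := by
  unfold ratchetBetaPlus
  have h := intervalIntegral.integral_comp_sub_left (a := 0) (b := 1)
    (fun x => Real.exp (ω * x + ψ x)) 1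
  simp only [sub_self, sub_zero] at h
  rw [← h, ← intervalIntegral.integral_const_mul]
  congr 1
  ext x
  rw [← hsym x, ← Real.exp_add]
  congr 1
  ring

lemma ratchetBetaMinus_neg (ψ : ℝ → ℝ) (hsym : ∀ x : ℝ, ψ x = ψ (1 - x)) (ω : ℝ) :
    ratchetBetaMinus (-ω) ψ = Real.exp ω * ratchetBetaMinus ω ψ := by
  unfold ratchetBetaMinus
  have h := intervalIntegral.integral_comp_sub_left (a := 0) (b := 1)
    (fun x => Real.exp (-(ω * x) - ψ x)) 1
  simp only [sub_self, sub_zero] at h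
  rw [← h, ← intervalIntegral.integral_const_mul]
  congr 1
  ext x
  rw [← hsym x, ← Real.exp_add]
  congr 1
  ring

lemma ratchetBeta_add_neg (ψ : ℝ → ℝ) (hc : Continuous ψ)
    (hsym : ∀ x : ℝ, ψ x = ψ (1 - x)) (ω : ℝ) :
    ratchetBeta ω ψ + ratchetBeta (-ω) ψ = ratchetBetaPlus ω ψ * ratchetBetaMinus ω ψ := by
  let F : ℝ → ℝ → ℝ := fun x y => Real.exp (ω * y + ψ y - ω * x - ψ x)
  have hF : Continuous (Function.uncurry F) := by
    simp only [F, Function.uncurry_def]; fun_prop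
  have hFx : ∀ x, Continuous (F x) := fun x => by simp only [F]; fun_prop
  have hneg : ratchetBeta (-ω) ψ = ∫ x in (0:ℝ)..1, ∫ y in x..1, F x y := by
    unfold ratchetBeta
    have h := intervalIntegral.integral_comp_sub_left (a := 0) (b := 1)
      (fun x => ∫ y in x..1, F x y) 1
    simp only [sub_self, sub_zero] at h
    rw [← h]
    congr 1
    ext x
    have h2 := intervalIntegral.integral_comp_sub_left (a := 0) (b := x)
      (fun y => F (1 - x) y) 1
    simp only [sub_zero] at h2
    rw [← h2]
    congr 1
    ext y
    simp only [F]
    rw [← hsym x, ← hsym y]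
    congr 1
    ring
  have hlow : Continuous fun x => ∫ y in (0:ℝ)..x, F x y :=
    intervalIntegral.continuous_parametric_intervalIntegral_of_continuous hF continuous_id
  have hup : Continuous fun x => ∫ y in x..(1:ℝ), F x y := by
    simp_rw [fun x => intervalIntegral.integral_symm (μ := volume) (f := F x) 1 x]
    exact (intervalIntegral.continuous_parametric_intervalIntegral_of_continuous hF
      continuous_id).neg
  rw [hneg]
  change (∫ x in (0:ℝ)..1, ∫ y in (0:ℝ)..x, F x y) + _ = _
  rw [← intervalIntegral.integral_add (hlow.intervalIntegrable _ _) (hup.intervalIntegrable _ _)]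
  unfold ratchetBetaPlus ratchetBetaMinus
  rw [← intervalIntegral.integral_const_mul]
  congr 1
  ext x
  rw [intervalIntegral.integral_add_adjacent_intervals ((hFx x).intervalIntegrable _ _)
    ((hFx x).intervalIntegrable _ _), ← intervalIntegral.integral_mul_const]
  congr 1
  ext y
  simp only [F]
  rw [← Real.exp_add]
  congr 1
  ring

/-- Symmetric potentials (`ψ(x) = ψ(1 − x)`) produce no adiabatic transport:
`J(ψ,ω) = 0` and `A(ω,ψ) + A(−ω,ψ) = 0`. -/
theorem symmetric_no_transport
    (ψ : ℝ → ℝ) (hc : Continuous ψ) (hper : Function.Periodic ψ 1)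
    (hsym : ∀ x : ℝ, ψ x = ψ (1 - x))
    (ω : ℝ) (hω : ω ≠ 0) :
    ratchetJ ψ ω = 0 ∧ ratchetA ω ψ + ratchetA (-ω) ψ = 0 := by
  constructor
  · unfold ratchetJ
    have h := ratchet_triangle
      (fun x y => Real.sinh (ψ x - ψ y) * Real.sinh (ω * (x - y - 1 / 2)))
      (by simp only [Function.uncurry_def]; fun_prop)
    have h2 : ∀ x y : ℝ, Real.sinh (ψ (1 - y) - ψ (1 - x)) *
        Real.sinh (ω * ((1 - y) - (1 - x) - 1 / 2))
        = -(Real.sinh (ψ x - ψ y) * Real.sinh (ω * (x - y - 1 / 2))) := by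
      intro x y
      rw [← hsym x, ← hsym y, ← neg_sub (ψ x) (ψ y), Real.sinh_neg,
        show (1 - y) - (1 - x) - 1 / 2 = x - y - 1 / 2 by ring]
      ring
    simp only [h2, intervalIntegral.integral_neg] at h
    rw [self_eq_neg.mp h, mul_zero]
  · have hb := ratchetBeta_add_neg ψ hc hsym ω
    have he : Real.exp (-ω) * Real.exp ω = 1 := by rw [← Real.exp_add]; simp
    have ha : ratchetAlpha (-ω) = Real.exp (-ω) * (-ratchetAlpha ω) := by
      unfold ratchetAlpha
      linear_combination he
    have hd : ratchetAlpha (-ω) * ratchetBeta (-ω) ψ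
        + ratchetBetaPlus (-ω) ψ * ratchetBetaMinus (-ω) ψ
        = Real.exp (-ω) * (ratchetAlpha ω * ratchetBeta ω ψ
          + ratchetBetaPlus ω ψ * ratchetBetaMinus ω ψ) := by
      rw [ha, ratchetBetaPlus_neg ψ hsym, ratchetBetaMinus_neg ψ hsym]
      unfold ratchetAlpha
      linear_combination (-(Real.exp (-ω) * (Real.exp ω - 1))) * hb
    unfold ratchetA
    rw [hd, ha, mul_div_mul_left _ _ (Real.exp_pos _).ne', neg_div, add_neg_cancel]
end

section
/- Let ω > 0 and set α(ω) = e^ω − 1. For a continuous strictly positive function F : [0,1] → ℝ define 𝒱_ω(F) = α(ω) ∫₀¹ ∫₀^x F(y)/F(x) dy dx + ∫₀¹ ∫₀¹ F(y)/F(x) dy dx. Then 𝒱_ω(F) ≥ α(ω)/ω for every such F, and equality holds if and only if there is a constant C > 0 with F(x) = C e^{ω x} for all x ∈ [0,1]. -/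
open MeasureTheory

/-- The functional
`𝒱_ω(F) = α(ω) ∫₀¹ ∫₀^x F(y)/F(x) dy dx + ∫₀¹ ∫₀¹ F(y)/F(x) dy dx`
with `α(ω) = e^ω − 1`. -/
noncomputable def ratchetV (ω : ℝ) (F : ℝ → ℝ) : ℝ :=
  (Real.exp ω - 1) * (∫ x in (0:ℝ)..1, ∫ y in (0:ℝ)..x, F y / F x) +
    ∫ x in (0:ℝ)..1, ∫ y in (0:ℝ)..1, F y / F x

theorem ratchetV_eq (ω : ℝ) (F : ℝ → ℝ) (hF : Continuous F) (hp : ∀ x, 0 < F x) :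
    ratchetV ω F = ∫ x in (0:ℝ)..1,
      ((Real.exp ω - 1) * (∫ y in (0:ℝ)..x, F y) + ∫ y in (0:ℝ)..1, F y) / F x := by
  have hne : ∀ x, F x ≠ 0 := fun x => (hp x).ne'
  have hcI : Continuous fun x => ∫ y in (0:ℝ)..x, F y :=
    intervalIntegral.continuous_primitive (fun a b => hF.intervalIntegrable a b) 0
  unfold ratchetV
  simp only [intervalIntegral.integral_div]
  rw [← intervalIntegral.integral_const_mul, ← intervalIntegral.integral_add]
  · congr 1
    ext x
    ring
  · exact ((hcI.div hF hne).const_mul _).intervalIntegrable _ _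
  · exact ((continuous_const.div hF hne)).intervalIntegrable _ _

theorem ratchetV_min_aux (ω : ℝ) (hω : 0 < ω) (F : ℝ → ℝ) (hF : Continuous F)
    (hp : ∀ x, 0 < F x) :
    (Real.exp ω - 1) / ω ≤ ratchetV ω F ∧
    (ratchetV ω F = (Real.exp ω - 1) / ω ↔
      ∃ C > (0:ℝ), ∀ x ∈ Set.Icc (0:ℝ) 1, F x = C * Real.exp (ω * x)) := by
  have hne : ∀ x, F x ≠ 0 := fun x => (hp x).ne'
  rw [ratchetV_eq ω F hF hp]
  have ha : 0 < Real.exp ω - 1 := by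
    have := Real.add_one_lt_exp hω.ne'
    linarith
  set a := Real.exp ω - 1 with ha_def
  set S := ∫ y in (0:ℝ)..1, F y with hS_def
  have hS : 0 < S := intervalIntegral.intervalIntegral_pos_of_pos
    (hF.intervalIntegrable _ _) hp one_pos
  set H : ℝ → ℝ := fun x => a * (∫ y in (0:ℝ)..x, F y) + S with hH_def
  have hHd : ∀ x, HasDerivAt H (a * F x) x := fun x =>
    ((hF.integral_hasStrictDerivAt 0 x).hasDerivAt.const_mul a).add_const S
  have hHc : Continuous H := continuous_iff_continuousAt.2 fun x => (hHd x).continuousAt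
  have hHp : ∀ x ∈ Set.Icc (0:ℝ) 1, 0 < H x := by
    intro x hx
    have : 0 ≤ ∫ y in (0:ℝ)..x, F y :=
      intervalIntegral.integral_nonneg hx.1 fun y _ => (hp y).le
    have := mul_nonneg ha.le this
    simp only [hH_def]
    linarith
  have hI : Set.uIcc (0:ℝ) 1 = Set.Icc 0 1 := Set.uIcc_of_le zero_le_one
  have hH0 : H 0 = S := by simp [hH_def]
  have hH1 : H 1 = Real.exp ω * S := by
    simp only [hH_def, ← hS_def, ha_def]
    ring
  have hGc : ContinuousOn (fun x => F x / H x) (Set.uIcc 0 1) := by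
    rw [hI]
    exact hF.continuousOn.div hHc.continuousOn fun x hx => (hHp x hx).ne'
  have hlog : ∫ x in (0:ℝ)..1, a * (F x / H x) = ω := by
    have := intervalIntegral.integral_eq_sub_of_hasDerivAt (a := 0) (b := 1)
      (f := fun x => Real.log (H x)) (f' := fun x => a * (F x / H x))
      (fun x hx => by
        rw [hI] at hx
        have := (hHd x).log (hHp x hx).ne'
        rwa [mul_div_assoc] at this)
      ((hGc.const_mul a).intervalIntegrable)
    rw [this, hH0, hH1, Real.log_mul (Real.exp_pos _).ne' hS.ne', Real.log_exp]
    ring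
  rw [intervalIntegral.integral_const_mul] at hlog
  have hGI : ∫ x in (0:ℝ)..1, F x / H x = ω / a := by
    rw [eq_div_iff ha.ne']; linarith
  set c := a / ω with hc_def
  have hc : 0 < c := div_pos ha hω
  have hHF : Continuous fun x => H x / F x := hHc.div hF hne
  have hcont : ContinuousOn (fun x => H x / F x - 2 * c + c ^ 2 * (F x / H x)) (Set.uIcc 0 1) :=
    (hHF.continuousOn.sub continuousOn_const).add (hGc.const_mul _)
  have hdiff : ∫ x in (0:ℝ)..1, (H x / F x - 2 * c + c ^ 2 * (F x / H x))
      = (∫ x in (0:ℝ)..1, H x / F x) - c := by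
    rw [intervalIntegral.integral_add, intervalIntegral.integral_sub,
      intervalIntegral.integral_const_mul, intervalIntegral.integral_const_mul, hGI,
      intervalIntegral.integral_const]
    · have hcc : c ^ 2 * (ω / a) = c := by
        simp only [hc_def]
        field_simp
      rw [hcc, smul_eq_mul]
      ring
    · exact hHF.intervalIntegrable _ _
    · exact intervalIntegrable_const
    · exact (hHF.sub continuous_const).intervalIntegrable _ _
    · exact (hGc.const_mul _).intervalIntegrable
  have hsq : ∀ x ∈ Set.Icc (0:ℝ) 1, H x / F x - 2 * c + c ^ 2 * (F x / H x)
      = (H x - c * F x) ^ 2 / (F x * H x) := by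
    intro x hx
    have h1 := (hHp x hx).ne'
    have h2 := hne x
    field_simp
    ring
  have hnn : ∀ x ∈ Set.Icc (0:ℝ) 1, 0 ≤ H x / F x - 2 * c + c ^ 2 * (F x / H x) := by
    intro x hx
    rw [hsq x hx]
    exact div_nonneg (sq_nonneg _) (mul_pos (hp x) (hHp x hx)).le
  refine ⟨?_, ?_, ?_⟩
  · have := intervalIntegral.integral_nonneg (μ := volume) zero_le_one hnn
    rw [hdiff] at this
    linarith
  · intro heq
    have hz : ∀ x ∈ Set.Icc (0:ℝ) 1, H x = c * F x := by
      by_contra! hcon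
      obtain ⟨x, hx, hxne⟩ := hcon
      have hpos : 0 < ∫ x in (0:ℝ)..1, (H x / F x - 2 * c + c ^ 2 * (F x / H x)) := by
        apply intervalIntegral.integral_pos zero_lt_one (hI ▸ hcont)
          (fun y hy => hnn y (Set.Ioc_subset_Icc_self hy))
        refine ⟨x, hx, ?_⟩
        rw [hsq x hx]
        exact div_pos (by have := sub_ne_zero.2 hxne; positivity) (mul_pos (hp x) (hHp x hx))
      rw [hdiff] at hpos
      linarith
    have hder : ∀ x, HasDerivAt (fun x => H x * Real.exp (-(ω * x)))
        (a * F x * Real.exp (-(ω * x)) + H x * (Real.exp (-(ω * x)) * (-(ω * 1)))) x := fun x =>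
      (hHd x).mul (((hasDerivAt_id x).const_mul ω).neg.exp)
    have hcst := constant_of_has_deriv_right_zero (a := 0) (b := 1)
      (f := fun x => H x * Real.exp (-(ω * x)))
      (fun x _ => (hder x).continuousAt.continuousWithinAt)
      (fun x hx => by
        have h := (hder x).hasDerivWithinAt (s := Set.Ici x)
        rw [hz x (Set.Ico_subset_Icc_self hx)] at h
        convert h using 1
        simp only [hc_def]
        field_simp
        ring)
    refine ⟨S / c, div_pos hS hc, fun x hx => ?_⟩
    have h := hcst x hx
    simp only [mul_zero, neg_zero, Real.exp_zero, mul_one, hH0, hz x hx, Real.exp_neg] at h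
    have he := (Real.exp_pos (ω * x)).ne'
    field_simp at h ⊢
    linarith
  · rintro ⟨C, hC, hCF⟩
    have hint : ∀ x ∈ Set.Icc (0:ℝ) 1, ∫ y in (0:ℝ)..x, F y
        = C / ω * (Real.exp (ω * x) - 1) := by
      intro x hx
      have h1 : ∫ y in (0:ℝ)..x, F y = ∫ y in (0:ℝ)..x, C * Real.exp (ω * y) := by
        apply intervalIntegral.integral_congr
        intro y hy
        rw [Set.uIcc_of_le hx.1] at hy
        exact hCF y ⟨hy.1, hy.2.trans hx.2⟩
      rw [h1, intervalIntegral.integral_const_mul,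
        intervalIntegral.integral_comp_mul_left (fun y => Real.exp y) hω.ne', integral_exp]
      simp
      ring
    have hS' : S = C / ω * a := by
      rw [hS_def, hint 1 (by simp), mul_one]
    have hcg : ∫ x in (0:ℝ)..1, H x / F x = ∫ x in (0:ℝ)..1, c := by
      apply intervalIntegral.integral_congr
      intro x hx
      rw [hI] at hx
      have he := (Real.exp_pos (ω * x)).ne'
      simp only [hH_def]
      rw [hint x hx, hCF x hx, hS', hc_def]
      field_simp
      ring
    rw [hcg]
    simp

/-- For `ω > 0`, the functional `𝒱_ω` attains its global minimum `α(ω)/ω` over continuous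
strictly positive `F : [0,1] → ℝ` exactly at the exponentials `F(x) = C e^{ωx}`. -/
theorem ratchetV_min
    (ω : ℝ) (hω : 0 < ω) (F : ℝ → ℝ)
    (hFc : ContinuousOn F (Set.Icc 0 1)) (hFpos : ∀ x ∈ Set.Icc (0:ℝ) 1, 0 < F x) :
    (Real.exp ω - 1) / ω ≤ ratchetV ω F ∧
    (ratchetV ω F = (Real.exp ω - 1) / ω ↔
      ∃ C > (0:ℝ), ∀ x ∈ Set.Icc (0:ℝ) 1, F x = C * Real.exp (ω * x)) := by
  set G : ℝ → ℝ := Set.IccExtend (zero_le_one (α := ℝ)) (Set.domRestrict (Set.Icc 0 1) F) with hG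
  have hGF : ∀ x ∈ Set.Icc (0:ℝ) 1, G x = F x := fun x hx => by
    rw [hG, Set.IccExtend_of_mem _ _ hx]; rfl
  have hGc : Continuous G := hFc.domRestrict.Icc_extend'
  have hGp : ∀ x, 0 < G x := fun x => hFpos _ (Set.projIcc 0 1 zero_le_one x).2
  have hV : ratchetV ω F = ratchetV ω G := by
    unfold ratchetV
    congr 1
    · congr 1
      apply intervalIntegral.integral_congr
      intro x hx
      rw [Set.uIcc_of_le zero_le_one] at hx
      apply intervalIntegral.integral_congr
      intro y hy
      rw [Set.uIcc_of_le hx.1] at hy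
      simp only [hGF x hx, hGF y ⟨hy.1, hy.2.trans hx.2⟩]
    · apply intervalIntegral.integral_congr
      intro x hx
      rw [Set.uIcc_of_le zero_le_one] at hx
      apply intervalIntegral.integral_congr
      intro y hy
      rw [Set.uIcc_of_le zero_le_one] at hy
      simp only [hGF x hx, hGF y hy]
  have key := ratchetV_min_aux ω hω G hGc hGp
  rw [hV]
  refine ⟨key.1, key.2.trans ?_⟩
  constructor
  · rintro ⟨C, hC, h⟩
    exact ⟨C, hC, fun x hx => by rw [← hGF x hx, h x hx]⟩
  · rintro ⟨C, hC, h⟩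
    exact ⟨C, hC, fun x hx => by rw [hGF x hx, h x hx]⟩
end

section
/- Let ψ : ℝ → ℝ be C⁴ and 1-periodic and let ω > 0. Then the quantity v_{∞∞}(ω) = ω − A(ω,ψ) satisfies 0 ≤ v_{∞∞}(ω) < ω, and v_{∞∞}(ω) = 0 if and only if ψ is constant. Equivalently, 0 < A(ω,ψ) ≤ ω, with A(ω,ψ) = ω if and only if ψ is constant. -/
open MeasureTheory

theorem ratchet_core (ψ : ℝ → ℝ) (hc : Continuous ψ) (hper : Function.Periodic ψ 1)
    (ω : ℝ) (hω : 0 < ω) :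
    0 < ratchetAlpha ω ∧
    ratchetAlpha ω ≤ ω * (ratchetAlpha ω * ratchetBeta ω ψ +
      ratchetBetaPlus ω ψ * ratchetBetaMinus ω ψ) ∧
    (ratchetAlpha ω = ω * (ratchetAlpha ω * ratchetBeta ω ψ +
      ratchetBetaPlus ω ψ * ratchetBetaMinus ω ψ) ↔ ∃ c : ℝ, ∀ x : ℝ, ψ x = c) := by
  have hα : 0 < ratchetAlpha ω := by
    unfold ratchetAlpha
    have := Real.add_one_lt_exp hω.ne'
    linarith
  refine ⟨hα, ?_⟩
  have hαdef : ratchetAlpha ω + 1 = Real.exp ω := by unfold ratchetAlpha; ring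
  set α := ratchetAlpha ω with hα0
  set E : ℝ → ℝ := fun x => Real.exp (ω * x + ψ x) with hE
  have hEc : Continuous E := by fun_prop
  have hEpos : ∀ x, 0 < E x := fun x => Real.exp_pos _
  set F : ℝ → ℝ := fun x => ∫ y in (0:ℝ)..x, E y with hF
  have hFd : ∀ x, HasDerivAt F (E x) x := fun x => by
    exact intervalIntegral.integral_hasDerivAt_right (hEc.intervalIntegrable _ _)
      (hEc.stronglyMeasurableAtFilter _ _) hEc.continuousAt
  have hFc : Continuous F := continuous_iff_continuousAt.2 fun x => (hFd x).continuousAt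
  have hF0 : F 0 = 0 := by simp [hF]
  have hF1 : 0 < F 1 := intervalIntegral.intervalIntegral_pos_of_pos
    (hEc.intervalIntegrable _ _) hEpos one_pos
  have hFnn : ∀ x, 0 ≤ x → 0 ≤ F x := fun x hx =>
    intervalIntegral.integral_nonneg hx fun u _ => (hEpos u).le
  set G : ℝ → ℝ := fun x => α * F x + F 1 with hG
  have hGd : ∀ x, HasDerivAt G (α * E x) x := fun x => ((hFd x).const_mul α).add_const _
  have hGc : Continuous G := by fun_prop
  have hGpos : ∀ x, 0 ≤ x → 0 < G x := fun x hx => by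
    have := mul_nonneg hα.le (hFnn x hx)
    simp only [hG]; linarith
  have hEi : Continuous fun x => (E x)⁻¹ := hEc.inv₀ fun x => (hEpos x).ne'
  have hD : α * ratchetBeta ω ψ + ratchetBetaPlus ω ψ * ratchetBetaMinus ω ψ
      = ∫ x in (0:ℝ)..1, G x * (E x)⁻¹ := by
    have h1 : ratchetBeta ω ψ = ∫ x in (0:ℝ)..1, F x * (E x)⁻¹ := by
      unfold ratchetBeta
      refine intervalIntegral.integral_congr fun x _ => ?_
      simp only [hF]
      rw [← intervalIntegral.integral_mul_const]
      refine intervalIntegral.integral_congr fun y _ => ?_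
      simp only [hE]
      rw [← Real.exp_neg, ← Real.exp_add]
      congr 1; ring
    have h2 : ratchetBetaMinus ω ψ = ∫ x in (0:ℝ)..1, (E x)⁻¹ := by
      unfold ratchetBetaMinus
      refine intervalIntegral.integral_congr fun x _ => ?_
      simp only [hE]
      rw [← Real.exp_neg]
      congr 1; ring
    have h3 : ratchetBetaPlus ω ψ = F 1 := rfl
    rw [h1, h2, h3, ← intervalIntegral.integral_const_mul, ← intervalIntegral.integral_const_mul,
      ← intervalIntegral.integral_add]
    · refine intervalIntegral.integral_congr fun x _ => ?_
      simp only [hG]; ring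
    · exact (Continuous.mul continuous_const (hFc.mul hEi)).intervalIntegrable _ _
    · exact (Continuous.mul continuous_const hEi).intervalIntegrable _ _
  have hI : Set.uIcc (0:ℝ) 1 = Set.Icc 0 1 := Set.uIcc_of_le zero_le_one
  have hhc : ContinuousOn (fun x => α * E x / G x) (Set.uIcc 0 1) := by
    rw [hI]
    exact ContinuousOn.div (by fun_prop) hGc.continuousOn fun x hx => (hGpos x hx.1).ne'
  have hlog : ∫ x in (0:ℝ)..1, α * E x / G x = ω := by
    rw [intervalIntegral.integral_eq_sub_of_hasDerivAt (f := fun x => Real.log (G x))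
      (fun x hx => (hGd x).log (hGpos x (by rw [hI] at hx; exact hx.1)).ne')
      hhc.intervalIntegrable]
    have e1 : G 1 = Real.exp ω * F 1 := by simp only [hG]; rw [← hαdef]; ring
    have e0 : G 0 = F 1 := by simp only [hG]; rw [hF0]; ring
    rw [e1, e0, Real.log_mul (Real.exp_pos _).ne' hF1.ne', Real.log_exp]; ring
  rw [hD]
  set D := ∫ x in (0:ℝ)..1, G x * (E x)⁻¹ with hDd
  set K : ℝ → ℝ := fun x => (ω⁻¹ ^ 2 * (α * E x / G x) - 2 * ω⁻¹) + α⁻¹ * (G x * (E x)⁻¹) with hK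
  have hKc : ContinuousOn K (Set.uIcc 0 1) := by
    refine ContinuousOn.add (ContinuousOn.sub (continuousOn_const.mul hhc) continuousOn_const) ?_
    exact (continuous_const.mul (hGc.mul hEi)).continuousOn
  have hKeq : ∀ x, 0 ≤ x → K x = (α * E x - ω * G x) ^ 2 / (ω ^ 2 * (α * E x * G x)) := by
    intro x hx
    have h1 := (hGpos x hx).ne'
    have h2 := (hEpos x).ne'
    simp only [hK]
    field_simp
    ring
  have hKi : ∫ x in (0:ℝ)..1, K x = α⁻¹ * D - ω⁻¹ := by
    simp only [hK]
    rw [intervalIntegral.integral_add, intervalIntegral.integral_sub,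
      intervalIntegral.integral_const_mul (ω⁻¹ ^ 2), intervalIntegral.integral_const_mul α⁻¹, hlog,
      ← hDd]
    · simp only [intervalIntegral.integral_const, smul_eq_mul]
      field_simp
      ring
    · exact (continuousOn_const.mul hhc).intervalIntegrable
    · exact intervalIntegrable_const
    · exact (ContinuousOn.sub (continuousOn_const.mul hhc) continuousOn_const).intervalIntegrable
    · exact (continuous_const.mul (hGc.mul hEi)).intervalIntegrable _ _
  have hKnn : ∀ x, 0 ≤ x → 0 ≤ K x := fun x hx => by
    rw [hKeq x hx]
    have h1 := hGpos x hx
    have h2 := hEpos x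
    positivity
  have hform : ω * D - α = α * ω * (α⁻¹ * D - ω⁻¹) := by field_simp
  have hαω : 0 < α * ω := mul_pos hα hω
  constructor
  · have : 0 ≤ α⁻¹ * D - ω⁻¹ := by
      rw [← hKi]
      exact intervalIntegral.integral_nonneg zero_le_one fun x hx => hKnn x hx.1
    have := mul_nonneg hαω.le this
    linarith
  constructor
  · intro heq
    have h0 : ∫ x in (0:ℝ)..1, K x = 0 := by
      rw [hKi]
      have : α * ω * (α⁻¹ * D - ω⁻¹) = 0 := by rw [← hform]; linarith
      exact (mul_eq_zero.1 this).resolve_left hαω.ne'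
    have hz : ∀ x ∈ Set.Icc (0:ℝ) 1, α * E x = ω * G x := by
      intro x hx
      by_contra hne
      have : 0 < ∫ x in (0:ℝ)..1, K x := by
        refine intervalIntegral.integral_pos one_pos (hI ▸ hKc) (fun y hy => hKnn y hy.1.le)
          ⟨x, hx, ?_⟩
        rw [hKeq x hx.1]
        have h1 := hGpos x hx.1
        have h2 := hEpos x
        have h3 : 0 < (α * E x - ω * G x) ^ 2 := by
          have := sub_ne_zero.2 hne
          positivity
        positivity
      linarith
    have hQd : ∀ x, HasDerivAt (fun x => G x * Real.exp (-(ω * x)))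
        (α * E x * Real.exp (-(ω * x)) + G x * (Real.exp (-(ω * x)) * (-(ω * 1)))) x := fun x =>
      (hGd x).mul (((hasDerivAt_id x).const_mul ω).neg.exp)
    have hconst : ∀ x ∈ Set.Icc (0:ℝ) 1, G x * Real.exp (-(ω * x)) = G 0 * Real.exp (-(ω * 0)) := by
      refine constant_of_has_deriv_right_zero
        (fun x _ => (hQd x).continuousAt.continuousWithinAt) fun x hx => ?_
      have h := (hQd x).hasDerivWithinAt (s := Set.Ici x)
      rw [hz x ⟨hx.1, hx.2.le⟩] at h
      convert h using 1
      ring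
    have hexp : ∀ x ∈ Set.Icc (0:ℝ) 1, α * Real.exp (ψ x) = ω * G 0 := by
      intro x hx
      have h1 := hconst x hx
      have h2 := hz x hx
      have h3 : E x * Real.exp (-(ω * x)) = Real.exp (ψ x) := by
        simp only [hE]
        rw [← Real.exp_add]; congr 1; ring
      rw [← h3, ← mul_assoc, h2, mul_assoc, h1]; simp
    refine ⟨ψ 0, fun x => ?_⟩
    obtain ⟨y, hy, hxy⟩ := hper.exists_mem_Ico₀ one_pos x
    rw [hxy]
    have h1 := hexp y ⟨hy.1, hy.2.le⟩
    have h2 := hexp 0 ⟨le_rfl, zero_le_one⟩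
    exact Real.exp_injective (mul_left_cancel₀ hα.ne' (h1.trans h2.symm))
  · rintro ⟨c, hcc⟩
    have hFx : ∀ x, F x = Real.exp c * (Real.exp (ω * x) - 1) / ω := by
      intro x
      have hd : ∀ y ∈ Set.uIcc 0 x, HasDerivAt (fun y => Real.exp c * Real.exp (ω * y) / ω) (E y) y := by
        intro y _
        have h := ((((hasDerivAt_id y).const_mul ω).exp).const_mul (Real.exp c)).div_const ω
        have e : E y = Real.exp c * (Real.exp (ω * y) * (ω * 1)) / ω := by
          simp only [hE, hcc]
          rw [Real.exp_add]
          field_simp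
        rw [e]
        exact h
      simp only [hF]
      rw [intervalIntegral.integral_eq_sub_of_hasDerivAt hd (hEc.intervalIntegrable _ _)]
      simp
      ring
    have hGE : ∀ x, α * E x = ω * G x := by
      intro x
      simp only [hG, hE, hcc]
      rw [hFx, hFx, Real.exp_add, mul_one, ← hαdef]
      field_simp
      ring
    have h0 : ∫ x in (0:ℝ)..1, K x = 0 := by
      rw [intervalIntegral.integral_congr (g := fun _ => (0:ℝ))]
      · simp
      · intro x hx
        rw [hI] at hx
        rw [hKeq x hx.1, hGE x]
        simp
    rw [hKi] at h0
    rw [h0] at hform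
    linarith

/-- Bounds for the semiadiabatic transport velocity `v_{∞∞}(ω) = ω − A(ω,ψ)`:
`0 ≤ v_{∞∞}(ω) < ω`, with `v_{∞∞}(ω) = 0` iff `ψ` is constant; equivalently
`0 < A(ω,ψ) ≤ ω` with `A(ω,ψ) = ω` iff `ψ` is constant. -/
theorem semiadiabatic_velocity_bounds
    (ψ : ℝ → ℝ) (hψ : ContDiff ℝ 4 ψ) (hper : Function.Periodic ψ 1)
    (ω : ℝ) (hω : 0 < ω) :
    (0 ≤ ω - ratchetA ω ψ ∧ ω - ratchetA ω ψ < ω ∧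
      (ω - ratchetA ω ψ = 0 ↔ ∃ c : ℝ, ∀ x : ℝ, ψ x = c)) ∧
    (0 < ratchetA ω ψ ∧ ratchetA ω ψ ≤ ω ∧
      (ratchetA ω ψ = ω ↔ ∃ c : ℝ, ∀ x : ℝ, ψ x = c)) := by
  obtain ⟨hα, hle, hiff⟩ := ratchet_core ψ hψ.continuous hper ω hω
  have hD : 0 < ratchetAlpha ω * ratchetBeta ω ψ + ratchetBetaPlus ω ψ * ratchetBetaMinus ω ψ :=
    pos_of_mul_pos_right (lt_of_lt_of_le hα hle) hω.le
  have h1 : 0 < ratchetA ω ψ := div_pos hα hD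
  have h2 : ratchetA ω ψ ≤ ω := (div_le_iff₀ hD).2 hle
  have h3 : ratchetA ω ψ = ω ↔ ∃ c : ℝ, ∀ x : ℝ, ψ x = c := by
    rw [← hiff]
    exact div_eq_iff hD.ne'
  refine ⟨⟨by linarith, by linarith, ?_⟩, h1, h2, h3⟩
  rw [← h3, sub_eq_zero, eq_comm]
end
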